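/- Let Ω be a nonempty closed convex subset of a real Hilbert space H, let h, ψ : Ω → ℝ be convex lower semicontinuous functionals, and assume the solution set Λ = argmin_{x ∈ Ω}(h(x) + ψ(x)) is nonempty. Define f(x, y) = h(y) − h(x). Let {xₙ} be generated by: x₁ = x ∈ Ω, Ω₁ = Ω; uₙ ∈ Ω satisfies f(uₙ, y) + ψ(y) − ψ(uₙ) + (1/rₙ)⟨uₙ − xₙ, y − uₙ⟩ ≥ 0 for all y ∈ Ω; Ω_{n+1} = {z ∈ Ωₙ : ‖uₙ − z‖ ≤ ‖xₙ − z‖}; x_{n+1} = P_{Ω_{n+1}} x, where {rₙ} ⊂ [a, ∞) for some a > 0. Then {xₙ} converges strongly to P_Λ x, the metric projection of x onto Λ. -/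

import Mathlib

open Filter Topology Bornology RealInnerProductSpace

noncomputable section

/-- Conditions (A1)–(A4) for a bifunction `f` on a set `S`. -/
def BifunctionConds {D : Type*} [NormedAddCommGroup D] [NormedSpace ℝ D]
    (S : Set D) (f : D → D → ℝ) : Prop :=
  (∀ x ∈ S, f x x = 0) ∧
    (∀ x ∈ S, ∀ y ∈ S, f x y + f y x ≤ 0) ∧
    (∀ x ∈ S, ∀ y ∈ S, ∀ z ∈ S,
      limsup (fun t : ℝ => f (t • z + (1 - t) • x) y) (𝓝[>] (0:ℝ)) ≤ f x y) ∧
    ∀ x ∈ S, ConvexOn ℝ S (f x) ∧ LowerSemicontinuousOn (f x) S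

/-- `P` is the metric projection of a Hilbert space onto the set `C`. -/
def IsMetricProjection {H : Type*} [NormedAddCommGroup H] [InnerProductSpace ℝ H]
    (C : Set H) (P : H → H) : Prop :=
  ∀ z : H, P z ∈ C ∧ ∀ w ∈ C, ‖z - P z‖ ≤ ‖z - w‖

/-- The Pythagorean inequality at a nearest point `p` of a convex set. -/
theorem Convex.norm_sub_sq_add_norm_sub_sq_le {H : Type*} [NormedAddCommGroup H]
    [InnerProductSpace ℝ H] {C : Set H} (hC : Convex ℝ C) {x p w : H} (hp : p ∈ C)
    (hmin : ∀ z ∈ C, ‖x - p‖ ≤ ‖x - z‖) (hw : w ∈ C) :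
    ‖x - p‖ ^ 2 + ‖p - w‖ ^ 2 ≤ ‖x - w‖ ^ 2 := by
  have : Nonempty C := ⟨⟨p, hp⟩⟩
  have hinf : ‖x - p‖ = ⨅ z : C, ‖x - z‖ := by
    apply le_antisymm
    · exact le_ciInf fun z => hmin z z.2
    · exact ciInf_le ⟨0, by rintro _ ⟨z, rfl⟩; exact norm_nonneg _⟩ (⟨p, hp⟩ : C)
  have hin := (norm_eq_iInf_iff_real_inner_le_zero hC hp).1 hinf w hw
  have hexp := norm_sub_sq_real (x - p) (w - p)
  rw [sub_sub_sub_cancel_right] at hexp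
  rw [norm_sub_rev p w]
  linarith

/-- The set of points at least as close to `u` as to `v` is convex. -/
theorem convex_setOf_norm_sub_le_norm_sub {H : Type*} [NormedAddCommGroup H]
    [InnerProductSpace ℝ H] (u v : H) : Convex ℝ {z : H | ‖u - z‖ ≤ ‖v - z‖} := by
  have heq : {z : H | ‖u - z‖ ≤ ‖v - z‖} =
      {z : H | innerₗ H (v - u) z ≤ (‖v‖ ^ 2 - ‖u‖ ^ 2) / 2} := by
    ext z
    simp only [Set.mem_ofPred_eq, innerₗ_apply_apply, inner_sub_left]
    rw [← sq_le_sq₀ (norm_nonneg _) (norm_nonneg _), norm_sub_sq_real, norm_sub_sq_real]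
    constructor <;> intro _ <;> linarith
  rw [heq]
  exact convex_halfSpace_le (innerₗ H (v - u)).isLinear _

/-- If `⟪u - v, p - u⟫` is nonnegative, then `u` is at least as close to `p` as `v` is. -/
theorem norm_sub_le_norm_sub_of_inner_nonneg {H : Type*} [NormedAddCommGroup H]
    [InnerProductSpace ℝ H] {u v p : H} (huv : 0 ≤ ⟪u - v, p - u⟫) : ‖u - p‖ ≤ ‖v - p‖ := by
  rw [← sq_le_sq₀ (norm_nonneg _) (norm_nonneg _)]
  have hexp := norm_add_sq_real (u - v) (p - u)
  rw [show u - v + (p - u) = p - v by abel] at hexp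
  rw [norm_sub_rev u p, norm_sub_rev v p]
  nlinarith [sq_nonneg ‖u - v‖]

/-- A sequence whose squared increments are dominated by the increments of a bounded
sequence is Cauchy. -/
theorem cauchySeq_of_norm_sub_sq_le {E : Type*} [SeminormedAddCommGroup E] {s : ℕ → E}
    {d : ℕ → ℝ} {B : ℝ} (hd : ∀ n, d n ≤ B)
    (hs : ∀ m n, m ≤ n → ‖s m - s n‖ ^ 2 ≤ d n - d m) : CauchySeq s := by
  have hmono : Monotone d := fun m n hmn => by
    linarith [hs m n hmn, sq_nonneg ‖s m - s n‖]
  have hlim := tendsto_atTop_ciSup hmono ⟨B, by rintro _ ⟨n, rfl⟩; exact hd n⟩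
  rw [Metric.cauchySeq_iff']
  intro ε hε
  obtain ⟨N, hN⟩ := Metric.cauchySeq_iff'.1 hlim.cauchySeq (ε ^ 2) (by positivity)
  refine ⟨N, fun n hn => ?_⟩
  have hdist := hN n hn
  rw [Real.dist_eq] at hdist
  rw [dist_comm, dist_eq_norm]
  exact lt_of_pow_lt_pow_left₀ 2 hε.le
    ((hs N n hn).trans_lt ((le_abs_self _).trans_lt hdist))

/-- A limit of approximate minimizers of a lower semicontinuous function is a minimizer. -/
theorem LowerSemicontinuousOn.le_of_tendsto_of_le_add {X : Type*} [TopologicalSpace X]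
    {S : Set X} {g : X → ℝ} (hg : LowerSemicontinuousOn g S) {u : ℕ → X} {q : X}
    (hq : q ∈ S) (huS : ∀ n, u n ∈ S) (hu : Tendsto u atTop (𝓝 q)) {c : ℝ} {e : ℕ → ℝ}
    (he : Tendsto e atTop (𝓝 0)) (hle : ∀ n, g (u n) ≤ c + e n) : g q ≤ c := by
  refine le_of_forall_lt fun y hy => ?_
  obtain ⟨y', hyy', hy'⟩ := exists_between hy
  have hev := (tendsto_nhdsWithin_iff.2 ⟨hu, Eventually.of_forall huS⟩).eventually (hg q hq y' hy')
  have hlim : Tendsto (fun n => c + e n) atTop (𝓝 c) := by simpa using he.const_add c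
  exact hyy'.trans_le (ge_of_tendsto hlim (hev.mono fun n hn => hn.le.trans (hle n)))

/-- optimization application, algorithm: the hybrid scheme converges strongly
to the metric projection of the initial point onto the set of minimizers of `h + ψ` over `Ω`. -/
theorem optimization_hybrid_scheme_strong_convergence
    {H : Type*} [NormedAddCommGroup H] [InnerProductSpace ℝ H] [CompleteSpace H]
    (Ω : Set H) (hΩne : Ω.Nonempty) (hΩcl : IsClosed Ω) (hΩcv : Convex ℝ Ω)
    (h ψ : H → ℝ)
    (hhcv : ConvexOn ℝ Ω h) (hhlsc : LowerSemicontinuousOn h Ω)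
    (hψcv : ConvexOn ℝ Ω ψ) (hψlsc : LowerSemicontinuousOn ψ Ω)
    (Λ : Set H) (hΛ : Λ = {z ∈ Ω | ∀ y ∈ Ω, h z + ψ z ≤ h y + ψ y})
    (hΛne : Λ.Nonempty)
    (f : H → H → ℝ) (hf : ∀ x y, f x y = h y - h x)
    (a : ℝ) (ha : 0 < a) (r : ℕ → ℝ) (hr : ∀ n, a ≤ r n)
    (x : H) (hx : x ∈ Ω)
    (xs us : ℕ → H) (Ωs : ℕ → Set H) (P : ℕ → H → H)
    (hx0 : xs 0 = x) (hΩ0 : Ωs 0 = Ω)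
    (hu : ∀ n, us n ∈ Ω ∧ ∀ w ∈ Ω,
      0 ≤ f (us n) w + ψ w - ψ (us n)
        + (1 / r n) * ⟪us n - xs n, w - us n⟫)
    (hΩs : ∀ n, Ωs (n + 1) = {z ∈ Ωs n | ‖us n - z‖ ≤ ‖xs n - z‖})
    (hP : ∀ n, IsMetricProjection (Ωs (n + 1)) (P (n + 1)))
    (hxs : ∀ n, xs (n + 1) = P (n + 1) x)
    (PΛ : H → H) (hPΛ : IsMetricProjection Λ PΛ) :
    Tendsto xs atTop (𝓝 (PΛ x)) := by
  subst hΛ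
  set g : H → ℝ := fun z => h z + ψ z with hg
  have hgcv : ConvexOn ℝ Ω g := hhcv.add hψcv
  have hglsc : LowerSemicontinuousOn g Ω := hhlsc.add hψlsc
  have hrpos : ∀ n, 0 < r n := fun n => ha.trans_le (hr n)
  have hvar : ∀ n, ∀ w ∈ Ω, g (us n) ≤ g w + (1 / r n) * ⟪us n - xs n, w - us n⟫ := by
    intro n w hw
    have := (hu n).2 w hw
    rw [hf] at this
    simp only [hg]
    linarith
  have hΛcv : Convex ℝ {z ∈ Ω | ∀ y ∈ Ω, h z + ψ z ≤ h y + ψ y} := by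
    intro p hp q hq s t hs ht hst
    refine ⟨hΩcv hp.1 hq.1 hs ht hst, fun y hy => ?_⟩
    refine (hgcv.2 hp.1 hq.1 hs ht hst).trans ?_
    have h1 := mul_le_mul_of_nonneg_left (hp.2 y hy) hs
    have h2 := mul_le_mul_of_nonneg_left (hq.2 y hy) ht
    have h3 : s * (h y + ψ y) + t * (h y + ψ y) = h y + ψ y := by rw [← add_mul, hst, one_mul]
    simp only [hg, smul_eq_mul]
    linarith
  have hsucc : ∀ n, Ωs (n + 1) ⊆ Ωs n := fun n => by
    rw [hΩs]
    exact fun z hz => hz.1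
  have hanti : Antitone Ωs := antitone_nat_of_succ_le hsucc
  have hcv : ∀ n, Convex ℝ (Ωs n) := by
    intro n
    induction n with
    | zero => rwa [hΩ0]
    | succ n ih =>
      rw [hΩs]
      exact ih.inter (convex_setOf_norm_sub_le_norm_sub (us n) (xs n))
  have hΛsub : ∀ n, ∀ p ∈ {z ∈ Ω | ∀ y ∈ Ω, h z + ψ z ≤ h y + ψ y}, p ∈ Ωs n := by
    intro n p hp
    induction n with
    | zero => rw [hΩ0]; exact hp.1
    | succ n ih =>
      rw [hΩs]
      refine ⟨ih, norm_sub_le_norm_sub_of_inner_nonneg ?_⟩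
      have h1 : g p ≤ g (us n) := hp.2 (us n) (hu n).1
      have h2 : 0 ≤ (1 / r n) * ⟪us n - xs n, p - us n⟫ := by linarith [hvar n p hp.1]
      exact nonneg_of_mul_nonneg_right h2 (one_div_pos.2 (hrpos n))
  have hnear : ∀ n, xs n ∈ Ωs n ∧ ∀ z ∈ Ωs n, ‖x - xs n‖ ≤ ‖x - z‖ := by
    intro n
    cases n with
    | zero => simp [hx0, hΩ0, hx]
    | succ n => rw [hxs]; exact hP n x
  have hΩmem : ∀ n, xs n ∈ Ω := fun n => hΩ0 ▸ hanti (Nat.zero_le n) (hnear n).1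
  obtain ⟨hPmem, hPmin⟩ := hPΛ x
  have hbound : ∀ n, ‖x - xs n‖ ≤ ‖x - PΛ x‖ := fun n => (hnear n).2 _ (hΛsub n _ hPmem)
  have hcauchy : CauchySeq xs := by
    refine cauchySeq_of_norm_sub_sq_le (d := fun n => ‖x - xs n‖ ^ 2) (B := ‖x - PΛ x‖ ^ 2)
      (fun n => pow_le_pow_left₀ (norm_nonneg _) (hbound n) 2) fun m n hmn => ?_
    have := (hcv m).norm_sub_sq_add_norm_sub_sq_le (hnear m).1 (hnear m).2
      (hanti hmn (hnear n).1)
    linarith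
  obtain ⟨q, hq⟩ := cauchySeq_tendsto_of_complete hcauchy
  have hqΩ : q ∈ Ω := hΩcl.mem_of_tendsto hq (Eventually.of_forall hΩmem)
  have hq1 : Tendsto (fun n => xs (n + 1)) atTop (𝓝 q) := hq.comp (tendsto_add_atTop_nat 1)
  have hclose : ∀ n, ‖us n - xs (n + 1)‖ ≤ ‖xs n - xs (n + 1)‖ := by
    intro n
    have := (hnear (n + 1)).1
    rw [hΩs] at this
    exact this.2
  have hgap : Tendsto (fun n => us n - xs (n + 1)) atTop (𝓝 0) :=
    squeeze_zero_norm hclose (by simpa using (hq.sub hq1).norm)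
  have hus : Tendsto us atTop (𝓝 q) := by simpa using hgap.add hq1
  have hqΛ : q ∈ {z ∈ Ω | ∀ y ∈ Ω, h z + ψ z ≤ h y + ψ y} := by
    refine ⟨hqΩ, fun w hw => ?_⟩
    have hprod : Tendsto (fun n => a⁻¹ * (‖us n - xs n‖ * ‖w - us n‖)) atTop (𝓝 0) := by
      simpa using ((hus.sub hq).norm.mul (hus.const_sub w).norm).const_mul a⁻¹
    refine hglsc.le_of_tendsto_of_le_add (c := g w) hqΩ (fun n => (hu n).1) hus hprod fun n => ?_
    have hcoef : 1 / r n ≤ a⁻¹ := by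
      rw [one_div]
      exact inv_anti₀ ha (hr n)
    refine (hvar n w hw).trans ?_
    have h1 := mul_le_mul_of_nonneg_left (real_inner_le_norm (us n - xs n) (w - us n))
      (one_div_pos.2 (hrpos n)).le
    have h2 := mul_le_mul_of_nonneg_right hcoef
      (mul_nonneg (norm_nonneg (us n - xs n)) (norm_nonneg (w - us n)))
    linarith
  have hqle : ‖x - q‖ ≤ ‖x - PΛ x‖ :=
    le_of_tendsto (hq.const_sub x).norm (Eventually.of_forall hbound)
  have hpyth := hΛcv.norm_sub_sq_add_norm_sub_sq_le hPmem hPmin hqΛ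
  have hzero : ‖PΛ x - q‖ ^ 2 ≤ 0 := by
    linarith [pow_le_pow_left₀ (norm_nonneg _) hqle 2]
  have hPq : PΛ x = q := by
    rw [← sub_eq_zero, ← norm_eq_zero]
    exact pow_eq_zero_iff two_ne_zero |>.1 (le_antisymm hzero (sq_nonneg _))
  rwa [hPq]
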